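/- Let n ≥ 24 be a multiple of 3 and let G = Circ[n, {1,3}]. Then ξ(G) = M(G) = Z(G) = 6. -/

import Mathlib

open scoped Classical

noncomputable section

namespace Paper

variable {V : Type*}

/-- The set of vertices eventually colored blue starting from `Z` under the
zero forcing color change rule. -/
inductive Forced (G : SimpleGraph V) (Z : Set V) : V → Prop
  | init (v : V) : v ∈ Z → Forced G Z v
  | force (u w : V) : Forced G Z u → G.Adj u w →
      (∀ x, G.Adj u x → x ≠ w → Forced G Z x) → Forced G Z w

/-- `Z` is a zero forcing set of `G`. -/
def IsZeroForcingSet (G : SimpleGraph V) (Z : Set V) : Prop := ∀ v, Forced G Z v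

/-- The zero forcing number `Z(G)`. -/
def zfn (G : SimpleGraph V) : ℕ :=
  sInf {m | ∃ Z : Set V, Z.ncard = m ∧ IsZeroForcingSet G Z}

/-- Membership in the set `S(F,G)` of symmetric matrices described by `G`. -/
def SMat (F : Type*) [Field F] (G : SimpleGraph V) (A : Matrix V V F) : Prop :=
  A.IsSymm ∧ ∀ i j : V, i ≠ j → (A i j ≠ 0 ↔ G.Adj i j)

/-- Maximum nullity `M(F,G)`. -/
def maxNullity (F : Type*) [Field F] [Fintype V] (G : SimpleGraph V) : ℕ :=
  sSup {m | ∃ A : Matrix V V F, SMat F G A ∧ Fintype.card V - A.rank = m}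

/-- Minimum rank `mr(F,G)`. -/
def minRank (F : Type*) [Field F] [Fintype V] (G : SimpleGraph V) : ℕ :=
  sInf {m | ∃ A : Matrix V V F, SMat F G A ∧ A.rank = m}

/-- The Strong Arnold Property. -/
def HasSAP [Fintype V] [DecidableEq V] (A : Matrix V V ℝ) : Prop :=
  ∀ X : Matrix V V ℝ, X.IsSymm → A * X = 0 → Matrix.hadamard A X = 0 →
    Matrix.hadamard (1 : Matrix V V ℝ) X = 0 → X = 0

/-- The Colin de Verdière type parameter `ξ(G)`. -/
def xi [Fintype V] [DecidableEq V] (G : SimpleGraph V) : ℕ :=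
  sSup {m | ∃ A : Matrix V V ℝ, SMat ℝ G A ∧ HasSAP A ∧ Fintype.card V - A.rank = m}

/-- The adjacency matrix of `G` with entries in `R`. -/
def adjMat (R : Type*) [Zero R] [One R] (G : SimpleGraph V) : Matrix V V R :=
  Matrix.of fun i j => if G.Adj i j then 1 else 0

/-- Minimum degree `δ(G)`. -/
def minDeg (G : SimpleGraph V) : ℕ :=
  sInf {d | ∃ v : V, (G.neighborSet v).ncard = d}

/-- Vertex connectivity `κ(G)`. -/
def vertexConnectivity [Fintype V] (G : SimpleGraph V) : ℕ :=
  if G = (⊤ : SimpleGraph V) then Fintype.card V - 1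
  else sInf {m | ∃ S : Set V, S.ncard = m ∧ ¬ (G.induce Sᶜ).Connected}

/-- The circulant graph `Circ[n,S]`. -/
def circG (n : ℕ) (S : Set ℕ) : SimpleGraph (ZMod n) :=
  SimpleGraph.fromRel (fun i j => ∃ s ∈ S, j = i + (s : ZMod n))


section ZeroForcing

/-- A null vector that vanishes on `Z` vanishes on every vertex forced by `Z`. -/
lemma Forced.eq_zero {F : Type*} [Field F] [Fintype V] {G : SimpleGraph V} {A : Matrix V V F}
    (hA : SMat F G A) {Z : Set V} {x : V → F} (hx : A.mulVec x = 0) (hZ : ∀ v ∈ Z, x v = 0)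
    {v : V} (hv : Forced G Z v) : x v = 0 := by
  induction hv with
  | init v h => exact hZ v h
  | force u w _ huw _ hu ih =>
    have h : ∑ j, A u j * x j = 0 := congrFun hx u
    rw [Finset.sum_eq_single w] at h
    · exact (mul_eq_zero.1 h).resolve_left ((hA.2 u w huw.ne).2 huw)
    · intro j _ hj
      by_cases huj : j = u
      · rw [huj, hu, mul_zero]
      · by_cases hadj : G.Adj u j
        · rw [ih j hadj hj, mul_zero]
        · rw [not_not.1 (mt (hA.2 u j (Ne.symm huj)).1 hadj), zero_mul]
    · simp

lemma card_sub_rank_eq_finrank_ker {F : Type*} [Field F] [Fintype V] (A : Matrix V V F) :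
    Fintype.card V - A.rank = Module.finrank F (LinearMap.ker A.mulVecLin) := by
  have := LinearMap.finrank_range_add_finrank_ker A.mulVecLin
  rw [Module.finrank_fintype_fun_eq_card] at this
  rw [Matrix.rank]
  omega

/-- The nullity is at most the size of any zero forcing set. -/
lemma nullity_le_ncard {F : Type*} [Field F] [Fintype V] {G : SimpleGraph V} {A : Matrix V V F}
    (hA : SMat F G A) {Z : Set V} (hZ : IsZeroForcingSet G Z) :
    Fintype.card V - A.rank ≤ Z.ncard := by
  rw [card_sub_rank_eq_finrank_ker]
  let f : LinearMap.ker A.mulVecLin →ₗ[F] (Z → F) :=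
    (LinearMap.funLeft F F (Subtype.val : Z → V)).comp (Submodule.subtype _)
  have hf : Function.Injective f := by
    rw [← LinearMap.ker_eq_bot, LinearMap.ker_eq_bot']
    rintro ⟨x, hx⟩ h0
    ext v
    refine (hZ v).eq_zero hA (x := x) (by simpa using hx) fun z hz => ?_
    exact congrFun h0 ⟨z, hz⟩
  have := LinearMap.finrank_le_finrank_of_injective hf
  rwa [Module.finrank_fintype_fun_eq_card, ← Nat.card_eq_fintype_card,
    Nat.card_coe_set_eq] at this

end ZeroForcing

/-- Complex independent null vectors of a real matrix bound its real nullity from below. -/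
lemma card_le_finrank_ker {ι : Type*} [Fintype V] [Fintype ι] (A : Matrix V V ℝ)
    (u : ι → V → ℂ) (hu : LinearIndependent ℂ u)
    (h : ∀ a i, ∑ j, (A i j : ℂ) * u a j = 0) :
    Fintype.card ι ≤ Module.finrank ℝ (LinearMap.ker A.mulVecLin) := by
  let B := Module.finBasis ℝ (LinearMap.ker A.mulVecLin)
  let w : Fin (Module.finrank ℝ (LinearMap.ker A.mulVecLin)) → V → ℂ :=
    fun k v => ((B k : V → ℝ) v : ℂ)
  have hreal : ∀ x : V → ℝ, A.mulVec x = 0 →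
      (fun v => (x v : ℂ)) ∈ Submodule.span ℂ (Set.range w) := by
    intro x hx
    have hx' : x ∈ LinearMap.ker A.mulVecLin := by simpa using hx
    have hs := B.sum_repr ⟨x, hx'⟩
    have : (fun v => (x v : ℂ)) = ∑ k, ((B.repr ⟨x, hx'⟩ k : ℝ) : ℂ) • w k := by
      ext v
      have hv := congrFun (congrArg Subtype.val hs) v
      simp only [Submodule.coe_sum, Finset.sum_apply, Submodule.coe_smul, Pi.smul_apply,
        smul_eq_mul] at hv
      simp only [Finset.sum_apply, Pi.smul_apply, smul_eq_mul, w]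
      rw [← hv]
      push_cast
      rfl
    rw [this]
    exact Submodule.sum_mem _ fun k _ => Submodule.smul_mem _ _ (Submodule.subset_span ⟨k, rfl⟩)
  have hspan : ∀ a, u a ∈ Submodule.span ℂ (Set.range w) := by
    intro a
    have hre : A.mulVec (fun v => (u a v).re) = 0 := by
      ext i
      have := congrArg Complex.re (h a i)
      simpa [Complex.re_sum, Matrix.mulVec, dotProduct] using this
    have him : A.mulVec (fun v => (u a v).im) = 0 := by
      ext i
      have := congrArg Complex.im (h a i)
      simpa [Complex.im_sum, Matrix.mulVec, dotProduct] using this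
    have : u a = (fun v => ((u a v).re : ℂ)) + Complex.I • fun v => ((u a v).im : ℂ) := by
      ext v
      simp [mul_comm Complex.I, Complex.re_add_im]
    rw [this]
    exact Submodule.add_mem _ (hreal _ hre) (Submodule.smul_mem _ _ (hreal _ him))
  have h1 : Fintype.card ι = Module.finrank ℂ (Submodule.span ℂ (Set.range u)) :=
    (finrank_span_eq_card hu).symm
  have h2 : Submodule.span ℂ (Set.range u) ≤ Submodule.span ℂ (Set.range w) :=
    Submodule.span_le.2 (by rintro _ ⟨a, rfl⟩; exact hspan a)
  calc Fintype.card ι = _ := h1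
    _ ≤ Module.finrank ℂ (Submodule.span ℂ (Set.range w)) := Submodule.finrank_mono h2
    _ ≤ _ := (finrank_range_le_card (R := ℂ) w).trans_eq (Fintype.card_fin _)

section Circulant

variable {n : ℕ}

lemma circG_adj_iff {i j : ZMod n} :
    (circG n {1, 3}).Adj i j ↔
      i ≠ j ∧ (j = i + 1 ∨ j = i + 3 ∨ i = j + 1 ∨ i = j + 3) := by
  simp [circG, or_assoc]

/-- A weighted version of `Circ[n,{1,3}]`: the edges of length three have weight `1/2`, the edge
between `i` and `i + 1` has weight `β i`, and the diagonal entry at `i` is `-γ i`. -/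
def wMat (β γ : ZMod n → ℝ) : Matrix (ZMod n) (ZMod n) ℝ :=
  Matrix.of fun i j =>
    (if j = i then -γ i else 0) + (if j = i + 3 then 1 / 2 else 0) +
      (if j = i - 3 then 1 / 2 else 0) + (if j = i + 1 then β i else 0) +
      (if j = i - 1 then β (i - 1) else 0)

lemma wMat_isSymm (β γ : ZMod n → ℝ) : (wMat β γ).IsSymm := by
  ext i j
  have e0 : i = j ↔ j = i := eq_comm
  have e1 : i = j + 3 ↔ j = i - 3 := by rw [eq_sub_iff_add_eq, eq_comm]
  have e2 : i = j - 3 ↔ j = i + 3 := by rw [eq_sub_iff_add_eq, eq_comm]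
  have e3 : i = j + 1 ↔ j = i - 1 := by rw [eq_sub_iff_add_eq, eq_comm]
  have e4 : i = j - 1 ↔ j = i + 1 := by rw [eq_sub_iff_add_eq, eq_comm]
  simp only [wMat, Matrix.transpose_apply, Matrix.of_apply, e0, e1, e2, e3, e4]
  have h0 : (if j = i then -γ j else 0) = if j = i then -γ i else 0 :=
    ite_congr rfl (fun h => by rw [h]) fun _ => rfl
  have h1 : (if j = i - 1 then β j else 0) = if j = i - 1 then β (i - 1) else 0 :=
    ite_congr rfl (fun h => by rw [h]) fun _ => rfl
  have h2 : (if j = i + 1 then β (j - 1) else 0) = if j = i + 1 then β i else 0 :=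
    ite_congr rfl (fun h => by rw [h, add_sub_cancel_right]) fun _ => rfl
  rw [h0, h1, h2]
  ring

lemma wMat_sMat {β : ZMod n → ℝ} (hβ : ∀ i, 0 < β i) (γ : ZMod n → ℝ) :
    SMat ℝ (circG n {1, 3}) (wMat β γ) := by
  refine ⟨wMat_isSymm β γ, fun i j hij => ?_⟩
  have e1 : i = j + 3 ↔ j = i - 3 := by rw [eq_sub_iff_add_eq, eq_comm]
  have e3 : i = j + 1 ↔ j = i - 1 := by rw [eq_sub_iff_add_eq, eq_comm]
  rw [circG_adj_iff, e1, e3]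
  have := hβ i
  have := hβ (i - 1)
  simp only [wMat, Matrix.of_apply, if_neg (Ne.symm hij), ne_eq, hij, not_false_eq_true, true_and]
  constructor
  · intro h
    by_contra! hc
    simp [hc] at h
  · intro h
    apply ne_of_gt
    split_ifs <;> first | positivity | simp_all

lemma wMat_sum {R : Type*} [CommRing R] [Algebra ℝ R] [NeZero n] (β γ : ZMod n → ℝ)
    (x : ZMod n → R) (i : ZMod n) :
    ∑ j, algebraMap ℝ R (wMat β γ i j) * x j =
      algebraMap ℝ R (-γ i) * x i + algebraMap ℝ R (1 / 2) * x (i + 3) +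
        algebraMap ℝ R (1 / 2) * x (i - 3) + algebraMap ℝ R (β i) * x (i + 1) +
        algebraMap ℝ R (β (i - 1)) * x (i - 1) := by
  simp only [wMat, Matrix.of_apply, map_add, add_mul, Finset.sum_add_distrib, apply_ite
    (algebraMap ℝ R), map_zero, ite_mul, zero_mul, Finset.sum_ite_eq', Finset.mem_univ, if_true]

/-- Six consecutive vertices force the whole graph. -/
lemma isZeroForcingSet_image [NeZero n] :
    IsZeroForcingSet (circG n {1, 3}) ((fun m : ℕ => (m : ZMod n)) '' Set.Iio 6) := by
  have key : ∀ m : ℕ, Forced (circG n {1, 3})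
      ((fun m : ℕ => (m : ZMod n)) '' Set.Iio 6) (m : ZMod n) := by
    intro m
    induction m using Nat.strong_induction_on with
    | _ m ih =>
      by_cases hm : m < 6
      · exact .init _ ⟨m, hm, rfl⟩
      · obtain ⟨k, rfl⟩ := Nat.exists_eq_add_of_le (not_lt.1 hm)
        have h0 := ih k (by omega)
        have h2 := ih (k + 2) (by omega)
        have h3 := ih (k + 3) (by omega)
        have h4 := ih (k + 4) (by omega)
        by_cases hne : ((k + 3 : ℕ) : ZMod n) = ((6 + k : ℕ) : ZMod n)
        · rwa [← hne]
        refine .force _ _ h3 (circG_adj_iff.2 ⟨hne, .inr (.inl ?_)⟩) ?_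
        · push_cast; ring
        · intro x hx hxne
          rcases (circG_adj_iff.1 hx).2 with h | h | h | h
          · convert h4 using 1
            rw [h]; push_cast; ring
          · exact absurd (by rw [h]; push_cast; ring) hxne
          · convert h2 using 1
            rw [← sub_eq_iff_eq_add] at h
            rw [← h]; push_cast; ring
          · convert h0 using 1
            rw [← sub_eq_iff_eq_add] at h
            rw [← h]; push_cast; ring
  intro v
  simpa using key v.val

lemma ncard_image_Iio_six (hn : 6 ≤ n) :
    ((fun m : ℕ => (m : ZMod n)) '' Set.Iio 6).ncard = 6 := by
  rw [Set.InjOn.ncard_image]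
  · rw [← Finset.coe_Iio, Set.ncard_coe_finset, Nat.card_Iio]
  · intro a ha b hb hab
    have ha' : a < n := lt_of_lt_of_le ha hn
    have hb' : b < n := lt_of_lt_of_le hb hn
    have := (ZMod.natCast_eq_natCast_iff' a b n).1 hab
    rwa [Nat.mod_eq_of_lt ha', Nat.mod_eq_of_lt hb'] at this

end Circulant

section ArnoldProperty

variable {n : ℕ} [NeZero n]

/-- A function on `ZMod n` whose values three steps apart have a ratio of modulus different from
one on a residue class modulo three vanishes on that class. -/
lemma eq_zero_of_mul_shift (h3 : 3 ∣ n) {α : ZMod n → ℝ} {r : ZMod 3} {p q : ℝ}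
    (hpq : p ^ 2 ≠ q ^ 2)
    (h : ∀ i : ZMod n, ZMod.castHom h3 (ZMod 3) i = r → p * α (i + 3) = q * α i) :
    ∀ i : ZMod n, ZMod.castHom h3 (ZMod 3) i = r → α i = 0 := by
  let T := fun i : ZMod n => if ZMod.castHom h3 (ZMod 3) i = r then α i ^ 2 else 0
  have hT : ∀ i, 0 ≤ T i := fun i => by
    simp only [T]
    split_ifs <;> positivity
  have hthree : (ZMod.castHom h3 (ZMod 3)) 3 = 0 := by
    rw [map_ofNat]
    rfl
  have hshift : ∑ i, T (i + 3) = ∑ i, T i := Equiv.sum_comp (Equiv.addRight (3 : ZMod n)) T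
  have hmul : p ^ 2 * ∑ i, T (i + 3) = q ^ 2 * ∑ i, T i := by
    rw [Finset.mul_sum, Finset.mul_sum]
    refine Finset.sum_congr rfl fun i _ => ?_
    simp only [T, map_add, hthree, add_zero]
    split_ifs with hi
    · rw [← mul_pow, h i hi, mul_pow]
    · simp
  have hsum : ∑ i, T i = 0 := by
    rw [hshift] at hmul
    have : (p ^ 2 - q ^ 2) * ∑ i, T i = 0 := by linarith
    exact (mul_eq_zero.1 this).resolve_left (sub_ne_zero.2 hpq)
  intro i hi
  have := (Finset.sum_eq_zero_iff_of_nonneg fun i _ => hT i).1 hsum i (Finset.mem_univ i)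
  simp only [T, if_pos hi] at this
  exact pow_eq_zero_iff two_ne_zero |>.1 this

lemma wMat_hasSAP [DecidableEq (ZMod n)] (h3 : 3 ∣ n) {b c : ZMod 3 → ℝ} (hb : ∀ r, 0 < b r)
    (hc : Function.Injective c) :
    HasSAP (wMat (fun i => b (ZMod.castHom h3 (ZMod 3) i))
      (fun i => c (ZMod.castHom h3 (ZMod 3) i))) := by
  intro X hX hAX hAoX hIoX
  set π := ZMod.castHom h3 (ZMod 3) with hπ
  have hthree : π 3 = 0 := by
    rw [map_ofNat]
    rfl
  have hS : ∀ i j, X i j = X j i := fun i j => hX.apply j i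
  have hrow : ∀ l j, -c (π l) * X l j + 1 / 2 * X (l + 3) j + 1 / 2 * X (l - 3) j +
      b (π l) * X (l + 1) j + b (π (l - 1)) * X (l - 1) j = 0 := by
    intro l j
    have h := congrFun (congrFun hAX l) j
    rw [Matrix.mul_apply, Matrix.zero_apply] at h
    exact (wMat_sum (R := ℝ) _ _ (fun i => X i j) l).symm.trans h
  have hdiag : ∀ j, X j j = 0 := fun j => by
    simpa using congrFun (congrFun hIoX j) j
  have hadj : ∀ i j, (circG n {1, 3}).Adj i j → X i j = 0 := by
    intro i j hij
    have h := congrFun (congrFun hAoX i) j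
    simp only [Matrix.hadamard_apply, Matrix.zero_apply] at h
    exact (mul_eq_zero.1 h).resolve_left
      (((wMat_sMat (β := fun i => b (π i)) (fun i => hb _) _).2 i j hij.ne).2 hij)
  have h1 : ∀ i j, j = i + 1 → X i j = 0 := by
    intro i j h
    by_cases hij : i = j
    · rw [hij, hdiag]
    · exact hadj _ _ (circG_adj_iff.2 ⟨hij, .inl h⟩)
  have h1' : ∀ i j, i = j + 1 → X i j = 0 := fun i j h => by rw [hS, h1 _ _ h]
  have h3' : ∀ i j, j = i + 3 → X i j = 0 := by
    intro i j h
    by_cases hij : i = j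
    · rw [hij, hdiag]
    · exact hadj _ _ (circG_adj_iff.2 ⟨hij, .inr (.inl h)⟩)
  have h3'' : ∀ i j, i = j + 3 → X i j = 0 := fun i j h => by rw [hS, h3' _ _ h]
  let α : ZMod n → ℝ := fun j => X (j + 2) j
  have rel1 : ∀ j, c (π j) * α (j + 3) = c (π j + 2) * α j := by
    intro j
    have e1 := hrow (j + 2) j
    have e2 := hrow (j + 3) (j + 5)
    rw [h3'' (j + 2 + 1) j (by ring), h1' (j + 2 - 1) j (by ring),
      h1 (j + 2 - 3) j (by ring), show j + 2 + 3 = j + 5 by ring, map_add, map_ofNat] at e1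
    rw [h1' (j + 3 + 3) (j + 5) (by ring), h1 (j + 3 + 1) (j + 5) (by ring),
      h3' (j + 3 - 1) (j + 5) (by ring), show j + 3 - 3 = j by ring, map_add, hthree, add_zero,
      hS (j + 3) (j + 5), hS j (j + 5), show j + 5 = j + 3 + 2 by ring] at e2
    rw [show j + 5 = j + 3 + 2 by ring] at e1
    simp only [α]
    linarith
  have rel2 : ∀ j, 1 / 2 * α (j - 2) + b (π j + 1) * α j =
      1 / 2 * α (j + 4) + b (π j + 2) * α (j + 2) := by
    intro j
    have e1 := hrow (j + 1) j
    have e2 := hrow (j + 3) (j + 4)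
    rw [h1' (j + 1) j rfl, show j + 1 - 1 = j by ring, hdiag, show j + 1 + 3 = j + 4 by ring,
      show j + 1 - 3 = j - 2 by ring, show j + 1 + 1 = j + 2 by ring, hS (j - 2) j, map_add,
      map_one] at e1
    rw [h1 (j + 3) (j + 4) (by ring), show j + 3 + 1 = j + 4 by ring, hdiag,
      show j + 3 - 3 = j by ring, show j + 3 - 1 = j + 2 by ring, hS (j + 2), hS j,
      show j + 3 + 3 = j + 4 + 2 by ring, map_add π j 2, map_ofNat] at e2
    have e3 : X (j + 4) (j + 2) = α (j + 2) := by
      simp only [α]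
      congr 1; ring
    have e4 : X j (j - 2) = α (j - 2) := by
      simp only [α]
      congr 1; ring
    have e5 : X (j + 2) j = α j := rfl
    have e6 : X (j + 4 + 2) (j + 4) = α (j + 4) := rfl
    rw [e4, e5] at e1
    rw [e3, e6] at e2
    linarith
  have hzero : ∀ r : ZMod 3, c r ^ 2 ≠ c (r + 2) ^ 2 → ∀ i, π i = r → α i = 0 := by
    intro r hr
    refine eq_zero_of_mul_shift h3 hr fun i hi => ?_
    have := rel1 i
    rwa [show π i = r from hi] at this
  have hα : ∀ j, α j = 0 := by
    intro j
    by_cases hr : c (π j) ^ 2 ≠ c (π j + 2) ^ 2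
    · exact hzero _ hr j rfl
    push Not at hr
    have d1 : ∀ r : ZMod 3, r ≠ r + 2 ∧ r + 1 ≠ r + 2 ∧ r + 1 ≠ r ∧ r + 1 + 2 = r ∧
        r + 2 + 2 = r + 1 ∧ r - 2 = r + 1 ∧ r + 4 = r + 1 := by decide
    obtain ⟨n1, n2, n3, s1, s2, s3, s4⟩ := d1 (π j)
    have hneg : c (π j) = -c (π j + 2) :=
      (sq_eq_sq_iff_eq_or_eq_neg.1 hr).resolve_left (hc.ne n1)
    have z1 : ∀ i, π i = π j + 1 → α i = 0 := by
      refine hzero _ fun h => ?_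
      rw [s1] at h
      rcases sq_eq_sq_iff_eq_or_eq_neg.1 h with h | h
      · exact hc.ne n3 h
      · exact hc.ne n2 (by rw [h, hneg, neg_neg])
    have z2 : ∀ i, π i = π j + 2 → α i = 0 := by
      refine hzero _ fun h => ?_
      rw [s2] at h
      rcases sq_eq_sq_iff_eq_or_eq_neg.1 h with h | h
      · exact hc.ne n2 h.symm
      · exact hc.ne n3 (by rw [hneg, h, neg_neg])
    have h := rel2 j
    rw [z1 (j - 2) (by rw [map_sub, map_ofNat, s3]), z1 (j + 4) (by rw [map_add, map_ofNat, s4]),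
      z2 (j + 2) (by rw [map_add, map_ofNat])] at h
    have : b (π j + 1) * α j = 0 := by linarith
    exact (mul_eq_zero.1 this).resolve_left (hb _).ne'
  have hcol : ∀ j : ZMod n, ∀ m : ℕ, X (j - 3 + (m : ZMod n)) j = 0 := by
    intro j m
    induction m using Nat.strong_induction_on with
    | _ m ih =>
      by_cases hm : m < 6
      · interval_cases m
        · exact h3' _ _ (by push_cast; ring)
        · rw [hS, ← hα (j - 2)]
          simp only [α]
          congr 1 <;> (push_cast; ring)
        · exact h1 _ _ (by push_cast; ring)
        · rw [← hdiag j]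
          congr 1
          push_cast; ring
        · exact h1' _ _ (by push_cast; ring)
        · rw [← hα j]
          simp only [α]
          congr 1
          push_cast; ring
      · obtain ⟨k, rfl⟩ := Nat.exists_eq_add_of_le (not_lt.1 hm)
        have e := hrow (j - 3 + (k : ZMod n) + 3) j
        have i0 := ih k (by omega)
        have i2 := ih (k + 2) (by omega)
        have i3 := ih (k + 3) (by omega)
        have i4 := ih (k + 4) (by omega)
        push_cast at i0 i2 i3 i4 ⊢
        rw [show j - 3 + (k : ZMod n) + 3 + 3 = j - 3 + (6 + k) by ring,
          show j - 3 + (k : ZMod n) + 3 - 3 = j - 3 + k by ring,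
          show j - 3 + (k : ZMod n) + 3 + 1 = j - 3 + (k + 4) by ring,
          show j - 3 + (k : ZMod n) + 3 - 1 = j - 3 + (k + 2) by ring,
          show j - 3 + (k : ZMod n) + 3 = j - 3 + (k + 3) by ring, i0, i2, i3, i4] at e
        linarith
  ext i j
  have := hcol j (i - (j - 3)).val
  rwa [ZMod.natCast_zmod_val, add_sub_cancel] at this

end ArnoldProperty

section Eigenvectors

lemma castHom_three {n : ℕ} (h3 : 3 ∣ n) : ZMod.castHom h3 (ZMod 3) 3 = 0 := by
  rw [map_ofNat]
  rfl

variable {n : ℕ} [NeZero n]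

/-- The coefficients, on the three residue classes, of a quasi-periodic null vector. -/
def nullCoeff (b c : ZMod 3 → ℝ) (t : ℝ) (ζ η : ℂ) (r : ZMod 3) : ℂ :=
  if r = 0 then (t - c 1) * (t - c 2) - b 1 ^ 2
  else if r = 1 then b 1 * b 2 * ζ ^ 2 - b 0 * (t - c 2) * η
  else b 0 * b 1 * η ^ 2 - b 2 * (t - c 1) * ζ

lemma nullCoeff_equation {b c : ZMod 3 → ℝ} {t : ℝ} {ζ η : ℂ} (hζη : ζ * η = 1)
    (ht : (ζ ^ 3 + η ^ 3) / 2 = t) (htc : ∃ r, t = c r)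
    (hsum : b 0 ^ 2 + b 1 ^ 2 + b 2 ^ 2 = 2 * (b 0 * b 1 * b 2))
    (hwt : b 1 ^ 2 * c 0 + b 2 ^ 2 * c 1 + b 0 ^ 2 * c 2 = 0) (r : ZMod 3) :
    (t - c r) * nullCoeff b c t ζ η r + b r * ζ * nullCoeff b c t ζ η (r + 1) +
      b (r - 1) * η * nullCoeff b c t ζ η (r - 1) = 0 := by
  have hdet : (t - c 0) * (t - c 1) * (t - c 2) = 0 := by
    obtain ⟨r, rfl⟩ := htc
    have : ∀ r : ZMod 3, r = 0 ∨ r = 1 ∨ r = 2 := by decide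
    rcases this r with rfl | rfl | rfl <;> ring
  have hdet' : ((t : ℂ) - c 0) * (t - c 1) * (t - c 2) = 0 := mod_cast hdet
  have hsum' : (b 0 : ℂ) ^ 2 + b 1 ^ 2 + b 2 ^ 2 = 2 * (b 0 * b 1 * b 2) := mod_cast hsum
  have hwt' : (b 1 : ℂ) ^ 2 * c 0 + b 2 ^ 2 * c 1 + b 0 ^ 2 * c 2 = 0 := mod_cast hwt
  have v0 : nullCoeff b c t ζ η 0 = (t - c 1) * (t - c 2) - b 1 ^ 2 := rfl
  have v1 : nullCoeff b c t ζ η 1 = b 1 * b 2 * ζ ^ 2 - b 0 * (t - c 2) * η := rfl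
  have v2 : nullCoeff b c t ζ η 2 = b 0 * b 1 * η ^ 2 - b 2 * (t - c 1) * ζ := rfl
  have cases3 : ∀ r : ZMod 3, (r = 0 ∧ r + 1 = 1 ∧ r - 1 = 2) ∨
    (r = 1 ∧ r + 1 = 2 ∧ r - 1 = 0) ∨ (r = 2 ∧ r + 1 = 0 ∧ r - 1 = 1) := by decide
  rcases cases3 r with ⟨h, h', h''⟩ | ⟨h, h', h''⟩ | ⟨h, h', h''⟩ <;>
    rw [h', h'', h, v0, v1, v2]
  · linear_combination hdet' - (t : ℂ) * hsum' + hwt' + 2 * (b 0 * b 1 * b 2 : ℂ) * ht +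
      (-(b 0 : ℂ) ^ 2 * (t - c 2) - b 2 ^ 2 * (t - c 1)) * hζη
  · linear_combination ((b 0 : ℂ) * b 1 ^ 2 * η) * hζη
  · linear_combination ((b 1 : ℂ) ^ 2 * b 2 * ζ) * hζη

/-- The quasi-periodic null vector with multiplier `ζ`. -/
def nullVec (h3 : 3 ∣ n) (b c : ZMod 3 → ℝ) (t : ℝ) {ζ : ℂ} (hζ : ζ ^ n = 1) (η : ℂ)
    (i : ZMod n) : ℂ :=
  nullCoeff b c t ζ η (ZMod.castHom h3 (ZMod 3) i) * AddChar.zmodChar n hζ i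

variable (h3 : 3 ∣ n) {b c : ZMod 3 → ℝ} {t : ℝ} {ζ η : ℂ} (hζ : ζ ^ n = 1)

lemma zmodChar_add_one (i : ZMod n) :
    AddChar.zmodChar n hζ (i + 1) = AddChar.zmodChar n hζ i * ζ := by
  have : AddChar.zmodChar n hζ 1 = ζ := by simpa using AddChar.zmodChar_apply' hζ 1
  rw [AddChar.map_add_eq_mul, this]

lemma zmodChar_add_three (i : ZMod n) :
    AddChar.zmodChar n hζ (i + 3) = AddChar.zmodChar n hζ i * ζ ^ 3 := by
  have : AddChar.zmodChar n hζ 3 = ζ ^ 3 := by simpa using AddChar.zmodChar_apply' hζ 3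
  rw [AddChar.map_add_eq_mul, this]

lemma nullVec_add_three (i : ZMod n) :
    nullVec h3 b c t hζ η (i + 3) = ζ ^ 3 * nullVec h3 b c t hζ η i := by
  rw [nullVec, nullVec, zmodChar_add_three, map_add, castHom_three, add_zero]
  ring

lemma nullVec_ne_zero (hζη : ζ * η = 1) (hb : ∀ r, 0 < b r) (him : (ζ ^ 3).im ≠ 0) :
    nullVec h3 b c t hζ η ≠ 0 := by
  intro h
  have h1 := congrFun h 1
  have hζ1 : AddChar.zmodChar n hζ 1 = ζ := by simpa using AddChar.zmodChar_apply' hζ 1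
  have hζ0 : ζ ≠ 0 := left_ne_zero_of_mul_eq_one hζη
  rw [nullVec, map_one, hζ1] at h1
  have h2 : (b 1 : ℂ) * b 2 * ζ ^ 2 - b 0 * (t - c 2) * η = 0 :=
    (mul_eq_zero.1 h1).resolve_right hζ0
  have h4 : ((b 1 * b 2 : ℝ) : ℂ) * ζ ^ 3 = ((b 0 * (t - c 2) : ℝ) : ℂ) := by
    push_cast
    linear_combination ζ * h2 + (b 0 : ℂ) * (t - c 2) * hζη
  have h5 := congrArg Complex.im h4
  rw [Complex.im_ofReal_mul, Complex.ofReal_im] at h5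
  exact (mul_pos (hb 1) (hb 2)).ne' ((mul_eq_zero.1 h5).resolve_right him)

lemma wMat_nullVec (hζη : ζ * η = 1)
    (ht : (ζ ^ 3 + η ^ 3) / 2 = t) (htc : ∃ r, t = c r)
    (hsum : b 0 ^ 2 + b 1 ^ 2 + b 2 ^ 2 = 2 * (b 0 * b 1 * b 2))
    (hwt : b 1 ^ 2 * c 0 + b 2 ^ 2 * c 1 + b 0 ^ 2 * c 2 = 0) (i : ZMod n) :
    ∑ j, (wMat (fun i => b (ZMod.castHom h3 (ZMod 3) i))
      (fun i => c (ZMod.castHom h3 (ZMod 3) i)) i j : ℂ) * nullVec h3 b c t hζ η j = 0 := by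
  have hsub3 : AddChar.zmodChar n hζ (i - 3) = AddChar.zmodChar n hζ i * η ^ 3 := by
    have := zmodChar_add_three hζ (i - 3)
    rw [sub_add_cancel] at this
    rw [this, mul_assoc, ← mul_pow, hζη, one_pow, mul_one]
  have hsub1 : AddChar.zmodChar n hζ (i - 1) = AddChar.zmodChar n hζ i * η := by
    have := zmodChar_add_one hζ (i - 1)
    rw [sub_add_cancel] at this
    rw [this, mul_assoc, hζη, mul_one]
  have h := wMat_sum (R := ℂ) (fun i => b (ZMod.castHom h3 (ZMod 3) i))
      (fun i => c (ZMod.castHom h3 (ZMod 3) i)) (nullVec h3 b c t hζ η) i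
  have heq := nullCoeff_equation hζη ht htc hsum hwt (ZMod.castHom h3 (ZMod 3) i)
  refine h.trans ?_
  simp only [nullVec, zmodChar_add_three, zmodChar_add_one, hsub3, hsub1, map_add, map_sub,
    map_one, castHom_three, add_zero, sub_zero, Complex.coe_algebraMap]
  push_cast
  linear_combination AddChar.zmodChar n hζ i * heq +
    nullCoeff b c t ζ η (ZMod.castHom h3 (ZMod 3) i) * AddChar.zmodChar n hζ i * ht

lemma six_le_nullity {b : ZMod 3 → ℝ} (hb : ∀ r, 0 < b r) {θ : ZMod 3 → ℝ}
    (hθ : Function.Injective θ) (hθ0 : ∀ r, 0 < θ r) (hθπ : ∀ r, θ r < Real.pi)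
    (hper : ∀ r, ∃ m : ℕ, (n : ℝ) * (θ r / 3) = m * (2 * Real.pi))
    (hsum : b 0 ^ 2 + b 1 ^ 2 + b 2 ^ 2 = 2 * (b 0 * b 1 * b 2))
    (hwt : b 1 ^ 2 * Real.cos (θ 0) + b 2 ^ 2 * Real.cos (θ 1) + b 0 ^ 2 * Real.cos (θ 2) = 0) :
    6 ≤ Module.finrank ℝ (LinearMap.ker
      (wMat (fun i => b (ZMod.castHom h3 (ZMod 3) i))
        (fun i => Real.cos (θ (ZMod.castHom h3 (ZMod 3) i)))).mulVecLin) := by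
  let φ : ZMod 3 × ℤˣ → ℝ := fun a => (a.2 : ℤ) * θ a.1
  let ζ : ZMod 3 × ℤˣ → ℂ := fun a => Complex.exp ((φ a / 3 : ℝ) * Complex.I)
  let η : ZMod 3 × ℤˣ → ℂ := fun a => Complex.exp (-((φ a / 3 : ℝ) * Complex.I))
  have hζη : ∀ a, ζ a * η a = 1 := fun a => by
    simp only [ζ, η]
    rw [← Complex.exp_add, add_neg_cancel, Complex.exp_zero]
  have hζ3 : ∀ a, ζ a ^ 3 = Complex.exp (φ a * Complex.I) := fun a => by
    simp only [ζ]
    rw [← Complex.exp_nat_mul]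
    congr 1
    push_cast
    ring
  have hη3 : ∀ a, η a ^ 3 = Complex.exp (-φ a * Complex.I) := fun a => by
    simp only [η]
    rw [← Complex.exp_nat_mul]
    congr 1
    push_cast
    ring
  have hunit : ∀ s : ℤˣ, s = 1 ∨ s = -1 := Int.units_eq_one_or
  have hcos : ∀ a, Real.cos (φ a) = Real.cos (θ a.1) := by
    rintro ⟨r, s⟩
    rcases hunit s with rfl | rfl <;> simp [φ]
  have hsin : ∀ a, Real.sin (φ a) = (a.2 : ℤ) * Real.sin (θ a.1) := by
    rintro ⟨r, s⟩
    rcases hunit s with rfl | rfl <;> simp [φ]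
  have hsinpos : ∀ r, 0 < Real.sin (θ r) := fun r => Real.sin_pos_of_pos_of_lt_pi (hθ0 r) (hθπ r)
  have hre : ∀ a, (ζ a ^ 3).re = Real.cos (θ a.1) := fun a => by
    rw [hζ3, Complex.exp_ofReal_mul_I_re, hcos]
  have him : ∀ a, (ζ a ^ 3).im = (a.2 : ℤ) * Real.sin (θ a.1) := fun a => by
    rw [hζ3, Complex.exp_ofReal_mul_I_im, hsin]
  have ht : ∀ a, (ζ a ^ 3 + η a ^ 3) / 2 = (Real.cos (θ a.1) : ℝ) := fun a => by
    rw [hζ3, hη3, ← hcos, Complex.ofReal_cos, Complex.cos]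
  have hζn : ∀ a, ζ a ^ n = 1 := by
    rintro ⟨r, s⟩
    obtain ⟨m, hm⟩ := hper r
    have hm' : (n : ℂ) * (θ r / 3) = m * (2 * Real.pi) := mod_cast hm
    simp only [ζ, φ]
    rw [← Complex.exp_nat_mul, Complex.exp_eq_one_iff]
    refine ⟨s * m, ?_⟩
    push_cast
    linear_combination (s : ℤ) * Complex.I * hm'
  have hinj : Function.Injective fun a => ζ a ^ 3 := by
    rintro ⟨r, s⟩ ⟨r', s'⟩ h
    have h1 := congrArg Complex.re h
    have h2 := congrArg Complex.im h
    simp only [hre, him] at h1 h2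
    have hr : r = r' := hθ (Real.injOn_cos ⟨(hθ0 r).le, (hθπ r).le⟩ ⟨(hθ0 r').le, (hθπ r').le⟩ h1)
    subst hr
    have hs := mul_right_cancel₀ (hsinpos r).ne' h2
    exact Prod.ext rfl (Units.ext (by exact_mod_cast hs))
  have hlin := Module.End.eigenvectors_linearIndependent'
    (LinearMap.funLeft ℂ ℂ (fun i : ZMod n => i + 3)) (fun a => ζ a ^ 3) hinj
    (fun a => nullVec h3 b (fun r => Real.cos (θ r)) (Real.cos (θ a.1)) (hζn a) (η a))
    fun a => by
      refine ⟨Module.End.mem_eigenspace_iff.2 (funext fun i => ?_),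
        nullVec_ne_zero h3 (hζn a) (hζη a) hb ?_⟩
      · exact nullVec_add_three h3 (hζn a) i
      · rw [him]
        exact mul_ne_zero (by exact_mod_cast a.2.ne_zero) (hsinpos a.1).ne'
  have hcard : Fintype.card (ZMod 3 × ℤˣ) = 6 := by
    rw [Fintype.card_prod, ZMod.card, Fintype.card_units_int]
  have hle := card_le_finrank_ker _ _ hlin fun a i =>
    wMat_nullVec h3 (hζn a) (hζη a) (ht a) ⟨a.1, rfl⟩ hsum hwt i
  exact hcard.symm.le.trans hle

end Eigenvectors

section Parameters

/-- Three reals of which the first is positive and the last negative have a vanishing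
combination with positive coefficients. -/
lemma exists_pos_combination_eq_zero {x y z : ℝ} (hx : 0 < x) (hz : z < 0) :
    ∃ u v w : ℝ, 0 < u ∧ 0 < v ∧ 0 < w ∧ u * x + v * y + w * z = 0 := by
  rcases le_or_gt 0 y with hy | hy
  · exact ⟨-z, -z, x + y, by linarith, by linarith, by linarith, by ring⟩
  · exact ⟨-(y + z), x, x, by linarith, hx, hx, by ring⟩

lemma exists_edge_weights {c : ZMod 3 → ℝ} (h0 : 0 < c 0) (h2 : c 2 < 0) :
    ∃ b : ZMod 3 → ℝ, (∀ r, 0 < b r) ∧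
      b 0 ^ 2 + b 1 ^ 2 + b 2 ^ 2 = 2 * (b 0 * b 1 * b 2) ∧
      b 1 ^ 2 * c 0 + b 2 ^ 2 * c 1 + b 0 ^ 2 * c 2 = 0 := by
  obtain ⟨u, v, w, hu, hv, hw, h⟩ := exists_pos_combination_eq_zero (y := c 1) h0 h2
  obtain ⟨p, hp, rfl⟩ : ∃ p, 0 < p ∧ p ^ 2 = u := ⟨√u, Real.sqrt_pos.2 hu, Real.sq_sqrt hu.le⟩
  obtain ⟨q, hq, rfl⟩ : ∃ q, 0 < q ∧ q ^ 2 = v := ⟨√v, Real.sqrt_pos.2 hv, Real.sq_sqrt hv.le⟩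
  obtain ⟨s, hs, rfl⟩ : ∃ s, 0 < s ∧ s ^ 2 = w := ⟨√w, Real.sqrt_pos.2 hw, Real.sq_sqrt hw.le⟩
  let l := (p ^ 2 + q ^ 2 + s ^ 2) / (2 * (p * q * s))
  have hl : 0 < l := by positivity
  have hl' : l * (2 * (p * q * s)) = p ^ 2 + q ^ 2 + s ^ 2 := div_mul_cancel₀ _ (by positivity)
  let b : ZMod 3 → ℝ := fun r => if r = 0 then l * s else if r = 1 then l * p else l * q
  have b0 : b 0 = l * s := rfl
  have b1 : b 1 = l * p := rfl
  have b2 : b 2 = l * q := rfl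
  refine ⟨b, fun r => ?_, ?_, ?_⟩
  · simp only [b]
    split_ifs <;> positivity
  · rw [b0, b1, b2]
    linear_combination -l ^ 2 * hl'
  · rw [b0, b1, b2]
    linear_combination l ^ 2 * h

lemma exists_angles {k : ℕ} (hk : 7 ≤ k) :
    ∃ θ : ZMod 3 → ℝ, Function.Injective θ ∧ (∀ r, 0 < θ r) ∧ (∀ r, θ r < Real.pi) ∧
      (∀ r, ∃ m : ℕ, ((3 * k : ℕ) : ℝ) * (θ r / 3) = m * (2 * Real.pi)) ∧
      0 < Real.cos (θ 0) ∧ Real.cos (θ 2) < 0 := by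
  let m : ZMod 3 → ℕ := fun r => if r = 0 then 1 else if r = 1 then 2 else (k - 1) / 2
  have cases3 : ∀ r : ZMod 3, r = 0 ∨ r = 1 ∨ r = 2 := by decide
  have m0 : m 0 = 1 := rfl
  have m1 : m 1 = 2 := rfl
  have m2 : m 2 = (k - 1) / 2 := rfl
  have hmpos : ∀ r, 0 < m r := fun r => by
    rcases cases3 r with rfl | rfl | rfl <;> omega
  have hmlt : ∀ r, 2 * m r < k := fun r => by
    rcases cases3 r with rfl | rfl | rfl <;> omega
  have hminj : Function.Injective m := fun r s h => by
    rcases cases3 r with rfl | rfl | rfl <;> rcases cases3 s with rfl | rfl | rfl <;>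
      first | rfl | omega
  have hk0 : (0 : ℝ) < k := by exact_mod_cast (by omega : 0 < k)
  have hpi := Real.pi_pos
  have hmlt' : ∀ r, 2 * (m r : ℝ) < k := fun r => by exact_mod_cast hmlt r
  have hmpos' : ∀ r, 0 < (m r : ℝ) := fun r => by exact_mod_cast hmpos r
  refine ⟨fun r => Real.pi * (2 * m r / k), fun r s h => hminj ?_, fun r => ?_, fun r => ?_,
    fun r => ⟨m r, ?_⟩, ?_, ?_⟩
  · have h' := mul_left_cancel₀ hpi.ne' h
    rw [div_left_inj' hk0.ne'] at h'
    exact_mod_cast mul_left_cancel₀ two_ne_zero h'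
  · have := hmpos' r
    positivity
  · exact mul_lt_of_lt_one_right hpi ((div_lt_one hk0).2 (hmlt' r))
  · push_cast
    field_simp
  · apply Real.cos_pos_of_mem_Ioo
    have h : 2 * (m 0 : ℝ) / k < 1 / 2 := by
      rw [div_lt_div_iff₀ hk0 two_pos]
      exact_mod_cast (by omega : 2 * m 0 * 2 < 1 * k)
    have h' : 0 < 2 * (m 0 : ℝ) / k := by
      have := hmpos' 0
      positivity
    constructor <;> nlinarith
  · have h : 1 / 2 < 2 * (m 2 : ℝ) / k := by
      rw [div_lt_div_iff₀ two_pos hk0]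
      exact_mod_cast (by omega : 1 * k < 2 * m 2 * 2)
    have h' : 2 * (m 2 : ℝ) / k < 1 := (div_lt_one hk0).2 (hmlt' 2)
    apply Real.cos_neg_of_pi_div_two_lt_of_lt <;> nlinarith

end Parameters

/-- The graph `Circ[n,{1,3}]` with `n` a multiple of three has a real matrix of nullity at least
six with the Strong Arnold Property. -/
lemma exists_hasSAP_six_le_nullity {n : ℕ} [NeZero n] [DecidableEq (ZMod n)] (hn : 21 ≤ n)
    (h3 : 3 ∣ n) :
    ∃ A : Matrix (ZMod n) (ZMod n) ℝ, SMat ℝ (circG n {1, 3}) A ∧ HasSAP A ∧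
      6 ≤ Fintype.card (ZMod n) - A.rank := by
  obtain ⟨k, hk⟩ := id h3
  obtain ⟨θ, hθ, hθ0, hθπ, hper, hc0, hc2⟩ := exists_angles (k := k) (by omega)
  obtain ⟨b, hb, hsum, hwt⟩ := exists_edge_weights (c := fun r => Real.cos (θ r)) hc0 hc2
  rw [← hk] at hper
  have hcinj : Function.Injective fun r => Real.cos (θ r) := fun r s h =>
    hθ (Real.injOn_cos ⟨(hθ0 r).le, (hθπ r).le⟩ ⟨(hθ0 s).le, (hθπ s).le⟩ h)
  have hSAP := wMat_hasSAP h3 hb hcinj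
  have hnull := six_le_nullity h3 hb hθ hθ0 hθπ hper hsum hwt
  rw [← card_sub_rank_eq_finrank_ker] at hnull
  exact ⟨_, wMat_sMat (fun i => hb _) _, hSAP, hnull⟩

theorem stmt11 (n : ℕ) (hn : 24 ≤ n) (h3 : 3 ∣ n) :
    haveI : NeZero n := ⟨by omega⟩
    xi (circG n {1, 3}) = 6 ∧ maxNullity ℝ (circG n {1, 3}) = 6 ∧
      zfn (circG n {1, 3}) = 6 := by
  have : NeZero n := ⟨by omega⟩
  have hupper : ∀ B, SMat ℝ (circG n {1, 3}) B → Fintype.card (ZMod n) - B.rank ≤ 6 :=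
    fun B hB => (nullity_le_ncard hB isZeroForcingSet_image).trans_eq
      (ncard_image_Iio_six (by omega))
  obtain ⟨A, hA, hSAP, hlower⟩ := exists_hasSAP_six_le_nullity (by omega) h3
  have hnull := le_antisymm (hupper A hA) hlower
  refine ⟨?_, ?_, ?_⟩
  · refine IsGreatest.csSup_eq ⟨⟨A, hA, hSAP, hnull⟩, ?_⟩
    rintro _ ⟨B, hB, -, rfl⟩
    exact hupper B hB
  · refine IsGreatest.csSup_eq ⟨⟨A, hA, hnull⟩, ?_⟩
    rintro _ ⟨B, hB, rfl⟩
    exact hupper B hB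
  · refine IsLeast.csInf_eq ⟨⟨_, ncard_image_Iio_six (by omega), isZeroForcingSet_image⟩, ?_⟩
    rintro _ ⟨Z, rfl, hZ⟩
    exact hlower.trans (nullity_le_ncard hA hZ)

end Paper
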